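/- Let A be a C*-algebra of stable rank 1. Let a be a positive element of M_n(A), b a positive element of M_m(A), and p a projection in M_k(A). If the block-diagonal element diag(a, p) is Cuntz subequivalent to diag(b, p) in the matrix algebra M_{max(n,m)+k}(A), then a is Cuntz subequivalent to b (in M_{max(n,m)}(A)). (Cancellation of projections in the Cuntz comparison of a stable rank 1 C*-algebra.) -/

import Mathlib

open Filter Topology Matrix

/-- `a` is Cuntz subequivalent to `b`: there is a sequence `dₙ` with `dₙ b dₙ* → a`. -/
def CuntzSubequivalent {D : Type*} [NonUnitalRing D] [TopologicalSpace D] [Star D]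
    (a b : D) : Prop :=
  ∃ d : ℕ → D, Tendsto (fun n => d n * b * star (d n)) atTop (𝓝 a)

/-- A C*-algebra has stable rank one if the invertible elements of its minimal
unitization are dense. -/
def StableRankOne (A : Type*) [NonUnitalCStarAlgebra A] : Prop :=
  Dense {x : Unitization ℂ A | IsUnit x}

/-- The embedding of `Mₙ(A)` into `M_N(A)` (for `n ≤ N`) as the upper-left corner,
padding with zeros. -/
def pad {A : Type*} [Zero A] {n N : ℕ} (a : Matrix (Fin n) (Fin n) A) :
    Matrix (Fin N) (Fin N) A := fun i j =>
  if hi : (i : ℕ) < n then if hj : (j : ℕ) < n then a ⟨i, hi⟩ ⟨j, hj⟩ else 0 else 0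

/-- Cuntz subequivalence as membership in the closure of the conjugates of `b`. -/
theorem cuntzSubequivalent_iff_mem_closure {D : Type*} [NonUnitalRing D] [TopologicalSpace D]
    [FirstCountableTopology D] [Star D] {a b : D} :
    CuntzSubequivalent a b ↔ a ∈ closure (Set.range fun d : D => d * b * star d) := by
  rw [mem_closure_iff_seq_limit]
  constructor
  · rintro ⟨d, hd⟩
    exact ⟨_, fun n => ⟨d n, rfl⟩, hd⟩
  · rintro ⟨x, hx, hlim⟩
    choose d hd using hx
    exact ⟨d, by simpa only [hd] using hlim⟩

/-- If `0 ≤ a ≤ b + δ` with `0 ≤ b`, then `a` is within `δ` of a conjugate of `b`. -/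
theorem exists_norm_conj_sub_le {D : Type*} [CStarAlgebra D] [PartialOrder D] [StarOrderedRing D]
    {a b : D} (ha : 0 ≤ a) (hb : 0 ≤ b) {δ : ℝ} (hδ : 0 < δ) (hab : a ≤ b + algebraMap ℝ D δ) :
    ∃ u : D, ‖u * b * star u - a‖ ≤ δ := by
  have hδ' : IsStrictlyPositive (algebraMap ℝ D δ) :=
    isStrictlyPositive_algebraMap hδ
  have hB : IsStrictlyPositive (b + algebraMap ℝ D δ) :=
    IsStrictlyPositive.nonneg_add hb hδ'
  set B := b + algebraMap ℝ D δ with hBdef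
  have hs : IsSelfAdjoint (CFC.sqrt a) := .of_nonneg (CFC.sqrt_nonneg a)
  have hr : IsSelfAdjoint (B ^ (-(1 / 2) : ℝ)) := .of_nonneg CFC.rpow_nonneg
  set u := CFC.sqrt a * B ^ (-(1 / 2) : ℝ) with hu
  have hu1 : ‖u‖ ≤ 1 := (le_iff_norm_sqrt_mul_rpow a B).1 hab
  have hstar : star u = B ^ (-(1 / 2) : ℝ) * CFC.sqrt a := by
    rw [hu, star_mul, hs.star_eq, hr.star_eq]
  have huB : u * B * star u = a := by
    calc u * B * star u
        = CFC.sqrt a * (B ^ (-(1 / 2) : ℝ) * B * B ^ (-(1 / 2) : ℝ)) * CFC.sqrt a := by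
          rw [hstar, hu]; simp only [mul_assoc]
      _ = a := by
          rw [CFC.conjugate_rpow_neg_one_half B, mul_one, CFC.sqrt_mul_sqrt_self a]
  refine ⟨u, ?_⟩
  have key : u * b * star u - a = -(δ • (u * star u)) := by
    have : b = B - algebraMap ℝ D δ := by simp [hBdef]
    rw [this, mul_sub, sub_mul, huB, Algebra.algebraMap_eq_smul_one]
    simp
  rw [key, norm_neg, norm_smul, CStarRing.norm_self_mul_star, Real.norm_of_nonneg hδ.le]
  calc δ * (‖u‖ * ‖u‖) ≤ δ * (1 * 1) := by gcongr
    _ = δ := by ring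

/-- If the corner of `x` at the projection `f` is left invertible, with left inverse `r`, then
row reduction turns an approximation `x (b + f) x* ≈ a + f` into `a ≤ z b z* + δ`. -/
theorem le_conj_add_of_corner_inverse {D : Type*} [CStarAlgebra D] [PartialOrder D]
    [StarOrderedRing D] {a b f x r : D} (hf : IsStarProjection f) (ha : IsSelfAdjoint a)
    (hb : IsSelfAdjoint b) (haf : f * a = 0) (hrf : r * f = r)
    (hrx : r * x * f = f) {δ : ℝ} (hδ : 0 < δ) (hδ1 : δ ≤ 1)
    (h : ‖x * (b + f) * star x - (a + f)‖ ≤ δ) :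
    ∃ z : D, a ≤ z * b * star z + algebraMap ℝ D δ := by
  have hff : f * f = f := hf.isIdempotentElem
  have hfs : star f = f := hf.isSelfAdjoint
  set y := x * (b + f) * star x with hy
  have hysa : IsSelfAdjoint (y - (a + f)) := by
    refine IsSelfAdjoint.sub ?_ (ha.add hf.isSelfAdjoint)
    exact (hb.add hf.isSelfAdjoint).conjugate x
  have hlow : a + f - algebraMap ℝ D δ ≤ y := by
    have h1 := hysa.neg_algebraMap_norm_le_self
    have h2 : algebraMap ℝ D ‖y - (a + f)‖ ≤ algebraMap ℝ D δ := algebraMap_mono D h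
    have h3 := (neg_le_neg h2).trans h1
    rw [neg_le_sub_iff_le_add] at h3
    rwa [sub_le_iff_le_add]
  set w := (1 - f) * x * r with hw
  set v := (1 - f) - w with hv
  have hfw : w * f = w := by rw [hw, mul_assoc, hrf]
  have hfw' : f * star w = star w := by simpa [hfs] using congrArg star hfw
  have hva : v * a = a := by
    have : w * a = 0 := by rw [← hfw, mul_assoc, haf, mul_zero]
    rw [hv, sub_mul, this, sub_mul, haf]; simp
  have hvf : v * f = -w := by rw [hv, sub_mul, hfw, sub_mul, hff]; simp
  have hvxf : v * x * f = 0 := by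
    have : w * x * f = (1 - f) * x * f := by
      rw [hw]; simp only [mul_assoc] at hrx ⊢; rw [hrx]
    rw [hv, sub_mul, sub_mul, this, sub_self]
  have hva' : a * star v = a := by simpa [ha.star_eq] using congrArg star hva
  have hvv : v * star v = (1 - f) + w * star w := by
    have h1 : w * (1 - f) = 0 := by rw [mul_sub, hfw]; simp
    have h2 : (1 - f) * star w = 0 := by rw [sub_mul, hfw']; simp
    have h3 : (1 - f) * (1 - f) = 1 - f := by simp [mul_sub, sub_mul, hff]
    have h4 : star v = (1 - f) - star w := by simp [hv, hfs]
    rw [h4, hv, mul_sub, sub_mul _ w, sub_mul _ w, h1, h2, h3]; abel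
  have hvfv : v * f * star v = w * star w := by
    have : f * star v = - star w := by simpa [hfs] using congrArg star hvf
    calc v * f * star v = (v * f) * (f * star v) := by
          rw [mul_assoc v f (f * star v), ← mul_assoc f f, hff, mul_assoc]
      _ = w * star w := by rw [hvf, this, neg_mul_neg]
  refine ⟨v * x, ?_⟩
  have hz : v * x * b * star (v * x) = v * y * star v := by
    have : v * x * (b + f) = v * x * b := by rw [mul_add, hvxf, add_zero]
    calc v * x * b * star (v * x) = v * x * (b + f) * star (v * x) := by rw [this]
      _ = v * y * star v := by rw [hy, star_mul]; simp only [mul_assoc]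
  have hconj := star_right_conjugate_le_conjugate hlow v
  have hexp : v * (a + f - algebraMap ℝ D δ) * star v
      = a + w * star w - δ • ((1 - f) + w * star w) := by
    rw [mul_sub, mul_add, sub_mul, add_mul, hva, hva', hvfv, Algebra.algebraMap_eq_smul_one,
      mul_smul_comm, mul_one, smul_mul_assoc, hvv]
  rw [hexp] at hconj
  rw [hz]
  have hpos : 0 ≤ (1 - δ) • (w * star w) + δ • f :=
    add_nonneg (smul_nonneg (by linarith) (mul_star_self_nonneg w))
      (smul_nonneg hδ.le hf.nonneg)
  calc a ≤ a + ((1 - δ) • (w * star w) + δ • f) := le_add_of_nonneg_right hpos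
    _ = (a + w * star w - δ • ((1 - f) + w * star w)) + algebraMap ℝ D δ := by
      rw [Algebra.algebraMap_eq_smul_one]; module
    _ ≤ _ := by gcongr

/-- Cancellation of a projection `f` whose corner has a dense set of left invertible elements. -/
theorem cuntzSubequivalent_of_add_corner {D : Type*} [CStarAlgebra D] {a b f : D}
    (ha : ∃ x, a = star x * x) (hb : ∃ x, b = star x * x) (hf : IsStarProjection f)
    (haf : f * a = 0)
    (hdense : ∀ x, f * x * f ∈ closure {t | f * t * f = t ∧ ∃ r, r * f = r ∧ r * t = f})
    (h : CuntzSubequivalent (a + f) (b + f)) : CuntzSubequivalent a b := by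
  let _ : PartialOrder D := CStarAlgebra.spectralOrder D
  have _ : StarOrderedRing D := CStarAlgebra.spectralOrderedRing D
  have ha0 : 0 ≤ a := by obtain ⟨x, rfl⟩ := ha; exact star_mul_self_nonneg x
  have hb0 : 0 ≤ b := by obtain ⟨x, rfl⟩ := hb; exact star_mul_self_nonneg x
  have hff : f * f = f := hf.isIdempotentElem
  rw [cuntzSubequivalent_iff_mem_closure] at h ⊢
  have hx : a + f ∈ closure ((fun x : D => x * (b + f) * star x) ''
      {x | ∃ r, r * f = r ∧ r * x * f = f}) := by
    rw [← closure_closure]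
    refine closure_mono ?_ h
    rintro _ ⟨x, rfl⟩
    have hcont : Continuous fun t : D => (x - f * x * f + t) * (b + f) *
        star (x - f * x * f + t) := by fun_prop
    have := map_mem_closure hcont (hdense x)
      (t := ((fun x : D => x * (b + f) * star x) ''
        {x | ∃ r, r * f = r ∧ r * x * f = f})) ?_
    · simpa using this
    · rintro t ⟨hft, r, hrf, hrt⟩
      refine ⟨x - f * x * f + t, ⟨r, hrf, ?_⟩, rfl⟩
      have h1 : r * (f * x * f) = r * x * f := by
        rw [← mul_assoc, ← mul_assoc, hrf]
      have h2 : t * f = t := by rw [← hft, mul_assoc, hff]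
      rw [mul_add, mul_sub, h1, add_mul, sub_mul, mul_assoc (r * x) f f, hff, sub_self, zero_add,
        mul_assoc, h2, hrt]
  rw [Metric.mem_closure_iff] at hx ⊢
  intro ε hε
  obtain ⟨_, ⟨x, ⟨r, hrf, hrx⟩, rfl⟩, hd⟩ := hx (min (ε / 2) 1) (by positivity)
  have hδ : 0 < min (ε / 2) 1 := by positivity
  rw [dist_comm, dist_eq_norm] at hd
  obtain ⟨z, hz⟩ := le_conj_add_of_corner_inverse hf (.of_nonneg ha0) (.of_nonneg hb0) haf hrf
    hrx hδ (min_le_right _ _) hd.le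
  obtain ⟨u, hu⟩ := exists_norm_conj_sub_le ha0 (star_right_conjugate_nonneg hb0 z) hδ hz
  refine ⟨_, ⟨u * z, rfl⟩, ?_⟩
  rw [dist_comm, dist_eq_norm]
  have : u * z * b * star (u * z) = u * (z * b * star z) * star u := by
    rw [star_mul]; simp only [mul_assoc]
  simp only [this]
  have := min_le_left (ε / 2) 1
  linarith

/-- A block matrix with invertible upper-left corner and invertible Schur complement is
invertible. -/
theorem isUnit_fromBlocks_of_schur {R l m : Type*} [Ring R] [Fintype l] [Fintype m]
    [DecidableEq l] [DecidableEq m] (a : (Matrix l l R)ˣ) (b : Matrix l m R) (c : Matrix m l R)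
    {s : Matrix m m R} (hs : IsUnit s) :
    IsUnit (fromBlocks (a : Matrix l l R) b c (s + c * (↑a⁻¹ : Matrix l l R) * b)) := by
  have hlower (u : Matrix m l R) : IsUnit (fromBlocks (1 : Matrix l l R) 0 u (1 : Matrix m m R)) :=
    isUnit_iff_exists.2 ⟨fromBlocks 1 0 (-u) 1, by simp [fromBlocks_multiply],
      by simp [fromBlocks_multiply]⟩
  have hupper (u : Matrix l m R) : IsUnit (fromBlocks (1 : Matrix l l R) u 0 (1 : Matrix m m R)) :=
    isUnit_iff_exists.2 ⟨fromBlocks 1 (-u) 0 1, by simp [fromBlocks_multiply],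
      by simp [fromBlocks_multiply]⟩
  obtain ⟨s, rfl⟩ := hs
  have hdiag : IsUnit (fromBlocks (a : Matrix l l R) 0 0 (s : Matrix m m R)) :=
    isUnit_iff_exists.2 ⟨fromBlocks (↑a⁻¹ : Matrix l l R) 0 0 (↑s⁻¹ : Matrix m m R),
      by simp [fromBlocks_multiply], by simp [fromBlocks_multiply]⟩
  convert ((hlower (c * (↑a⁻¹ : Matrix l l R))).mul hdiag).mul
    (hupper ((↑a⁻¹ : Matrix l l R) * b)) using 1
  simp [fromBlocks_multiply, Matrix.mul_assoc, ← Matrix.mul_assoc (a : Matrix l l R), add_comm]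

/-- Density of the invertibles passes from the diagonal blocks to block matrices. -/
theorem dense_isUnit_fromBlocks {R l m : Type*} [Ring R] [TopologicalSpace R] [IsTopologicalRing R]
    [Fintype l] [Fintype m] [DecidableEq l] [DecidableEq m]
    (hl : Dense {M : Matrix l l R | IsUnit M}) (hm : Dense {M : Matrix m m R | IsUnit M}) :
    Dense {M : Matrix (l ⊕ m) (l ⊕ m) R | IsUnit M} := by
  intro M
  rw [← fromBlocks_toBlocks M]
  generalize M.toBlocks₁₁ = a, M.toBlocks₁₂ = b, M.toBlocks₂₁ = c, M.toBlocks₂₂ = d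
  have hcont : Continuous fun a' : Matrix l l R => fromBlocks a' b c d := by fun_prop
  rw [← closure_closure]
  refine map_mem_closure (f := fun a' => fromBlocks a' b c d) hcont (hl a) ?_
  rintro _ ⟨a', rfl⟩
  have hcont' : Continuous fun s : Matrix m m R =>
      fromBlocks (a' : Matrix l l R) b c (s + c * (↑a'⁻¹ : Matrix l l R) * b) := by fun_prop
  have := map_mem_closure hcont' (hm (d - c * (↑a'⁻¹ : Matrix l l R) * b))
    (t := {M | IsUnit M}) (fun s hs => isUnit_fromBlocks_of_schur a' b c hs)
  simpa using this

/-- Matrix rings over a ring with dense invertibles have dense invertibles. -/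
theorem dense_isUnit_matrix {R : Type*} [Ring R] [TopologicalSpace R] [IsTopologicalRing R]
    (h : Dense {x : R | IsUnit x}) (n : ℕ) : Dense {M : Matrix (Fin n) (Fin n) R | IsUnit M} := by
  induction n with
  | zero => exact fun M => subset_closure (isUnit_of_subsingleton M)
  | succ n ih =>
    have hone : Dense {M : Matrix (Fin 1) (Fin 1) R | IsUnit M} := by
      intro M
      have hcont : Continuous (scalar (Fin 1) : R →+* Matrix (Fin 1) (Fin 1) R) :=
        Continuous.matrix_diagonal (continuous_pi fun _ => continuous_id)
      have := map_mem_closure hcont (h (M 0 0)) (t := {M | IsUnit M})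
        (fun x hx => IsUnit.map (scalar (Fin 1)) hx)
      convert this
      ext i j
      simp [Subsingleton.elim i 0, Subsingleton.elim j 0]
    intro M
    have hcont : Continuous (reindexRingEquiv R (finSumFinEquiv (m := n) (n := 1))) :=
      continuous_id.matrix_reindex _ _
    have := map_mem_closure hcont
      (dense_isUnit_fromBlocks ih hone ((reindexRingEquiv R finSumFinEquiv).symm M))
      (t := {M | IsUnit M}) (fun x hx => IsUnit.map (reindexRingEquiv R finSumFinEquiv) hx)
    simpa using this

/-- Adding the same projection `q`, orthogonal to `a` and `b`, preserves Cuntz subequivalence. -/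
theorem CuntzSubequivalent.add_orthogonal {D : Type*} [Ring D] [StarRing D] [TopologicalSpace D]
    [IsTopologicalRing D] {a b q : D} (hq : IsStarProjection q) (haq : a * q = 0) (hqa : q * a = 0)
    (hbq : b * q = 0) (hqb : q * b = 0) (h : CuntzSubequivalent a b) :
    CuntzSubequivalent (a + q) (b + q) := by
  obtain ⟨d, hd⟩ := h
  have hqq : q * q = q := hq.isIdempotentElem
  have hqs : star q = q := hq.isSelfAdjoint
  refine ⟨fun n => (1 - q) * d n * (1 - q) + q, ?_⟩
  have hlim : Tendsto (fun n => (1 - q) * (d n * b * star (d n)) * (1 - q) + q) atTop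
      (𝓝 ((1 - q) * a * (1 - q) + q)) := by
    have hcont : Continuous fun x : D => (1 - q) * x * (1 - q) + q := by fun_prop
    exact (hcont.tendsto a).comp hd
  have ha : (1 - q) * a * (1 - q) = a := by simp [sub_mul, mul_sub, haq, hqa]
  rw [ha] at hlim
  refine hlim.congr fun n => ?_
  have h1 : (1 - q) * q = 0 := by simp [sub_mul, hqq]
  have h2 : q * (1 - q) = 0 := by simp [mul_sub, hqq]
  have h3 : (1 - q) * b = b := by simp [sub_mul, hqb]
  have h4 : b * (1 - q) = b := by simp [mul_sub, hbq]
  have h5 : ((1 - q) * d n * (1 - q) + q) * (b + q) = (1 - q) * d n * b + q := by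
    rw [add_mul, mul_assoc _ (1 - q), mul_add (1 - q), h3, h1, mul_add q, hqb, hqq]; simp
  have h6 : star ((1 - q) * d n * (1 - q) + q) = (1 - q) * star (d n) * (1 - q) + q := by
    simp [hqs, mul_assoc]
  have h7 : q * ((1 - q) * star (d n) * (1 - q)) = 0 := by rw [← mul_assoc, ← mul_assoc, h2]; simp
  have h8 : b * ((1 - q) * star (d n) * (1 - q)) = b * star (d n) * (1 - q) := by
    rw [← mul_assoc, ← mul_assoc, h4]
  rw [h5, h6, add_mul, mul_add, mul_add, hqq, h7, mul_assoc _ b q, hbq,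
    mul_assoc ((1 - q) * d n) b, h8]
  simp only [mul_assoc, mul_zero, add_zero, zero_add]

/-- Cancellation of projections in matrices over a unital C⋆-algebra with dense invertibles. -/
theorem cuntzSubequivalent_of_fromBlocks_projection {B : Type*} [CStarAlgebra B]
    (hB : Dense {x : B | IsUnit x}) {N k : ℕ} {a b : Matrix (Fin N) (Fin N) B}
    {p : Matrix (Fin k) (Fin k) B} (ha : ∃ x, a = star x * x) (hb : ∃ x, b = star x * x)
    (hp : IsStarProjection p)
    (h : CuntzSubequivalent (fromBlocks a 0 0 p) (fromBlocks b 0 0 p)) :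
    CuntzSubequivalent a b := by
  let _ : PartialOrder B := CStarAlgebra.spectralOrder B
  have _ : StarOrderedRing B := CStarAlgebra.spectralOrderedRing B
  have hpp : p * p = p := hp.isIdempotentElem
  set f : Matrix (Fin N ⊕ Fin k) (Fin N ⊕ Fin k) B := fromBlocks 0 0 0 1 with hfdef
  have hproj {q : Matrix (Fin k) (Fin k) B} (hq : IsStarProjection q) :
      IsStarProjection (fromBlocks (0 : Matrix (Fin N) (Fin N) B) 0 0 q) := by
    refine ⟨?_, ?_⟩
    · simp [IsIdempotentElem, fromBlocks_multiply, hq.isIdempotentElem.eq]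
    · have := hq.isSelfAdjoint.star_eq
      rw [star_eq_conjTranspose] at this
      simp [IsSelfAdjoint, star_eq_conjTranspose, fromBlocks_conjTranspose, this]
  have hf : IsStarProjection f := hproj (.one _)
  have h1 : CuntzSubequivalent (fromBlocks a 0 0 0 + f) (fromBlocks b 0 0 0 + f) := by
    have := h.add_orthogonal (hproj hp.one_sub)
      (by simp [fromBlocks_multiply, mul_sub, hpp]) (by simp [fromBlocks_multiply, sub_mul, hpp])
      (by simp [fromBlocks_multiply, mul_sub, hpp]) (by simp [fromBlocks_multiply, sub_mul, hpp])
    simpa [hfdef, fromBlocks_add] using this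
  have hpos {c : Matrix (Fin N) (Fin N) B} (hc : ∃ x, c = star x * x) :
      ∃ x : Matrix (Fin N ⊕ Fin k) (Fin N ⊕ Fin k) B, fromBlocks c 0 0 0 = star x * x := by
    obtain ⟨x, rfl⟩ := hc
    exact ⟨fromBlocks x 0 0 0,
      by simp [star_eq_conjTranspose, fromBlocks_conjTranspose, fromBlocks_multiply]⟩
  have hdense (x : Matrix (Fin N ⊕ Fin k) (Fin N ⊕ Fin k) B) : f * x * f ∈
      closure {t | f * t * f = t ∧ ∃ r, r * f = r ∧ r * t = f} := by
    have hcont : Continuous fun t : Matrix (Fin k) (Fin k) B =>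
      fromBlocks (0 : Matrix (Fin N) (Fin N) B) 0 0 t := by fun_prop
    have := map_mem_closure hcont (dense_isUnit_matrix hB k x.toBlocks₂₂)
      (t := {t | f * t * f = t ∧ ∃ r, r * f = r ∧ r * t = f}) ?_
    · convert this using 1
      conv_lhs => rw [← fromBlocks_toBlocks x]
      simp [hfdef, fromBlocks_multiply]
    · rintro _ ⟨t, rfl⟩
      refine ⟨by simp [hfdef, fromBlocks_multiply],
        fromBlocks 0 0 0 (↑t⁻¹ : Matrix (Fin k) (Fin k) B), ?_, ?_⟩ <;>
        simp [hfdef, fromBlocks_multiply]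
  have hfa : f * fromBlocks a 0 0 0 = 0 := by simp [hfdef, fromBlocks_multiply]
  have h2 : CuntzSubequivalent (fromBlocks a 0 0 0 : Matrix (Fin N ⊕ Fin k) (Fin N ⊕ Fin k) B)
      (fromBlocks b 0 0 0) :=
    cuntzSubequivalent_of_add_corner (D := CStarMatrix (Fin N ⊕ Fin k) (Fin N ⊕ Fin k) B)
      (hpos ha) (hpos hb) ⟨hf.1, hf.2⟩ hfa hdense h1
  obtain ⟨d, hd⟩ := h2
  refine ⟨fun n => (d n).toBlocks₁₁, ?_⟩
  have hcont : Continuous (toBlocks₁₁ : Matrix (Fin N ⊕ Fin k) (Fin N ⊕ Fin k) B → _) :=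
    continuous_id.matrix_submatrix Sum.inl Sum.inl
  refine ((hcont.tendsto _).comp hd).congr fun n => ?_
  simp only [Function.comp_apply]
  conv_lhs => rw [← fromBlocks_toBlocks (d n)]
  simp [star_eq_conjTranspose, fromBlocks_conjTranspose, fromBlocks_multiply]

/-- In a C⋆-algebra, conjugation by an approximate unit converges to the identity. -/
theorem tendsto_approximateUnit_conj {A : Type*} [NonUnitalCStarAlgebra A] [PartialOrder A]
    [StarOrderedRing A] (x : A) :
    Tendsto (fun f => f * x * f) (CStarAlgebra.approximateUnit A) (𝓝 x) := by
  have hl := CStarAlgebra.increasingApproximateUnit A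
  have hleft := tendsto_iff_norm_sub_tendsto_zero.1 (hl.tendsto_mul_left x)
  have hright := tendsto_iff_norm_sub_tendsto_zero.1 (hl.tendsto_mul_right x)
  rw [tendsto_iff_norm_sub_tendsto_zero]
  refine squeeze_zero' (.of_forall fun _ => norm_nonneg _) ?_ (by simpa using hleft.add hright)
  filter_upwards [hl.eventually_norm] with f hf
  calc ‖f * x * f - x‖ = ‖f * (x * f - x) + (f * x - x)‖ := by
        congr 1; rw [mul_sub, mul_assoc]; abel
    _ ≤ ‖f‖ * ‖x * f - x‖ + ‖f * x - x‖ :=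
        (norm_add_le _ _).trans (by gcongr; exact norm_mul_le _ _)
    _ ≤ 1 * ‖x * f - x‖ + ‖f * x - x‖ := by gcongr
    _ = ‖x * f - x‖ + ‖f * x - x‖ := by rw [one_mul]

/-- Cuntz subequivalence in matrices over the unitization descends to the algebra itself. -/
theorem cuntzSubequivalent_of_map_inr {A ι : Type*} [NonUnitalCStarAlgebra A] [Fintype ι]
    {a b : Matrix ι ι A}
    (h : CuntzSubequivalent (a.map (Unitization.inr : A → Unitization ℂ A))
      (b.map (Unitization.inr : A → Unitization ℂ A))) : CuntzSubequivalent a b := by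
  let _ : PartialOrder A := CStarAlgebra.spectralOrder A
  have _ : StarOrderedRing A := CStarAlgebra.spectralOrderedRing A
  have hl := CStarAlgebra.increasingApproximateUnit A
  have : FirstCountableTopology (Matrix ι ι A) :=
    inferInstanceAs (FirstCountableTopology (ι → ι → A))
  have : FirstCountableTopology (Matrix ι ι (Unitization ℂ A)) :=
    inferInstanceAs (FirstCountableTopology (ι → ι → Unitization ℂ A))
  rw [cuntzSubequivalent_iff_mem_closure] at h ⊢
  have := hl.neBot
  rw [← closure_closure]
  have hlim : Tendsto (fun f : A => a.map fun x => f * x * f) (CStarAlgebra.approximateUnit A)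
      (𝓝 a) :=
    tendsto_pi_nhds.2 fun i => tendsto_pi_nhds.2 fun j => tendsto_approximateUnit_conj (a i j)
  refine mem_closure_of_tendsto hlim ?_
  filter_upwards [hl.eventually_star_eq] with f hf
  have hcont : Continuous fun M : Matrix ι ι (Unitization ℂ A) =>
      M.map fun x => ((f : Unitization ℂ A) * x * f).snd := by
    refine continuous_id.matrix_map ?_
    exact Unitization.continuous_snd.comp (by fun_prop)
  have hmem := map_mem_closure hcont h (t := Set.range fun d : Matrix ι ι A => d * b * star d) ?_
  · convert hmem using 1
    ext i j
    simp
  · rintro _ ⟨d, rfl⟩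
    refine ⟨d.map fun x => ((f : Unitization ℂ A) * x).snd, ?_⟩
    have hsnd (x : Unitization ℂ A) :
        ((((f : Unitization ℂ A) * x).snd : A) : Unitization ℂ A) = f * x := by
      ext <;> simp
    ext i j
    apply Unitization.inr_injective (R := ℂ)
    have hsnd' (x : Unitization ℂ A) :
        ((((f : Unitization ℂ A) * x * f).snd : A) : Unitization ℂ A) = f * x * f := by
      ext <;> simp
    have hstar (x : Unitization ℂ A) :
        ((star ((f : Unitization ℂ A) * x).snd : A) : Unitization ℂ A) = star x * f := by
      rw [Unitization.inr_star, hsnd, star_mul, ← Unitization.inr_star, hf]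
    have hsum {s : ι → A} : ((∑ i, s i : A) : Unitization ℂ A) = ∑ i, (s i : Unitization ℂ A) :=
      map_sum (Unitization.inrNonUnitalAlgHom ℂ A) s Finset.univ
    refine Eq.trans ?_
      (hsnd' ((d * b.map Unitization.inr * star d : Matrix ι ι (Unitization ℂ A)) i j)).symm
    simp only [mul_apply, map_apply, star_apply, hsum, Unitization.inr_mul, hsnd, hstar,
      Finset.mul_sum, Finset.sum_mul, mul_assoc]

/-- Padding is multiplicative. -/
theorem pad_mul {A : Type*} [NonUnitalNonAssocSemiring A] {n N : ℕ} (h : n ≤ N)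
    (x y : Matrix (Fin n) (Fin n) A) : (pad (x * y) : Matrix (Fin N) (Fin N) A) = pad x * pad y := by
  ext i j
  simp only [mul_apply]
  by_cases hi : (i : ℕ) < n
  · by_cases hj : (j : ℕ) < n
    · simp only [pad, hi, hj, dite_true, mul_apply]
      refine Fintype.sum_of_injective (Fin.castLE h) (Fin.castLE_injective h) _ _ ?_ ?_
      · intro l hl
        have : ¬ (l : ℕ) < n := fun hl' => hl ⟨⟨l, hl'⟩, rfl⟩
        simp [this]
      · intro l
        simp
    · simp [pad, hj]
  · simp [pad, hi]

/-- Padding commutes with the adjoint. -/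
theorem pad_star {A : Type*} [NonUnitalSemiring A] [StarRing A] {n N : ℕ}
    (x : Matrix (Fin n) (Fin n) A) : (pad (star x) : Matrix (Fin N) (Fin N) A) = star (pad x) := by
  ext i j
  simp only [pad, star_apply]
  split_ifs <;> simp

/-- Cancellation of projections in the Cuntz comparison over a stable rank one
C*-algebra: if `diag(a, p) ≾ diag(b, p)` with `p` a projection, then `a ≾ b`. -/
theorem cuntzSubequivalent_of_add_projection
    {A : Type*} [NonUnitalCStarAlgebra A] (hA : StableRankOne A)
    {n m k : ℕ}
    (a : Matrix (Fin n) (Fin n) A) (b : Matrix (Fin m) (Fin m) A)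
    (p : Matrix (Fin k) (Fin k) A)
    (ha : ∃ x : Matrix (Fin n) (Fin n) A, a = star x * x)
    (hb : ∃ x : Matrix (Fin m) (Fin m) A, b = star x * x)
    (hp : IsSelfAdjoint p ∧ IsIdempotentElem p)
    (h : CuntzSubequivalent
          (Matrix.fromBlocks (pad (N := max n m) a) 0 0 p)
          (Matrix.fromBlocks (pad (N := max n m) b) 0 0 p)) :
    CuntzSubequivalent (pad (N := max n m) a) (pad (N := max n m) b) := by
  have hmul {ι : Type} [Fintype ι] (x y : Matrix ι ι A) :
      (x * y).map (Unitization.inr : A → Unitization ℂ A) = x.map Unitization.inr *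
        y.map Unitization.inr :=
    Matrix.map_mul (f := Unitization.inrNonUnitalAlgHom ℂ A)
  have hstar {ι : Type} (x : Matrix ι ι A) :
      (star x).map (Unitization.inr : A → Unitization ℂ A) = star (x.map Unitization.inr) := by
    ext i j : 1
    simp
  have hblocks (c : Matrix (Fin (max n m)) (Fin (max n m)) A) :
      (fromBlocks c 0 0 p).map (Unitization.inr : A → Unitization ℂ A) =
        fromBlocks (c.map Unitization.inr) 0 0 (p.map Unitization.inr) := by
    rw [fromBlocks_map, Matrix.map_zero _ (Unitization.inr_zero ℂ),
      Matrix.map_zero _ (Unitization.inr_zero ℂ)]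
  have hpos {l : ℕ} (hl : l ≤ max n m) {c : Matrix (Fin l) (Fin l) A}
      (hc : ∃ x : Matrix (Fin l) (Fin l) A, c = star x * x) :
      ∃ y, (pad (N := max n m) c).map (Unitization.inr : A → Unitization ℂ A) = star y * y := by
    obtain ⟨x, rfl⟩ := hc
    exact ⟨(pad x).map Unitization.inr, by rw [pad_mul hl, pad_star, hmul, hstar]⟩
  refine cuntzSubequivalent_of_map_inr
    (cuntzSubequivalent_of_fromBlocks_projection hA (p := p.map Unitization.inr)
      (hpos (le_max_left n m) ha) (hpos (le_max_right n m) hb) ⟨?_, ?_⟩ ?_)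
  · rw [IsIdempotentElem, ← hmul, hp.2.eq]
  · rw [IsSelfAdjoint, ← hstar, hp.1.star_eq]
  · obtain ⟨d, hd⟩ := h
    refine ⟨fun i => (d i).map Unitization.inr, ?_⟩
    have hcont : Continuous fun M : Matrix (Fin (max n m) ⊕ Fin k) (Fin (max n m) ⊕ Fin k) A =>
        M.map (Unitization.inr : A → Unitization ℂ A) :=
      continuous_id.matrix_map Unitization.continuous_inr
    have hlim := (hcont.tendsto _).comp hd
    rw [hblocks] at hlim
    refine hlim.congr fun i => ?_
    simp only [Function.comp_apply]
    rw [hmul, hmul, hstar, hblocks]
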